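/- arXiv:1012.5641 — 2 statements merged into one kernel-verified Lean document; each statement's English description precedes it below -/
import Mathlib

section
/- Let G be a smooth generalized subbundle of the trivial bundle ℝⁿ × ℝᵐ. Then G is globally finitely generated: there exist finitely many smooth maps s_1, …, s_k : ℝⁿ → ℝᵐ with s_i(p) ∈ G(p) for all p and all i, such that G(p) = span{s_1(p), …, s_k(p)} for every p ∈ ℝⁿ. -/
open scoped ContDiff in
/-- A sequence of compactly supported smooth maps can be rescaled by positive constants so that
its series converges pointwise and has a smooth sum. -/
theorem exists_pos_contDiff_tsum_smul {E F : Type*} [NormedAddCommGroup E] [NormedSpace ℝ E]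
    [NormedAddCommGroup F] [NormedSpace ℝ F] [CompleteSpace F] (g : ℕ → E → F)
    (g_smooth : ∀ i, ContDiff ℝ ∞ (g i)) (g_supp : ∀ i, HasCompactSupport (g i)) :
    ∃ r : ℕ → ℝ, (∀ i, 0 < r i) ∧ (∀ x, Summable fun i ↦ r i • g i x) ∧
      ContDiff ℝ ∞ fun x ↦ ∑' i, r i • g i x := by
  have hδ : Summable fun i : ℕ ↦ (1 / 2 : ℝ) ^ i := summable_geometric_two
  have key : ∀ n, ∃ r : ℝ, 0 < r ∧
      ∀ k ≤ n, ∀ x, ‖iteratedFDeriv ℝ k (r • g n) x‖ ≤ (1 / 2 : ℝ) ^ n := by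
    intro n
    have bound : ∀ k, ∃ R, ∀ x, ‖iteratedFDeriv ℝ k (g n) x‖ ≤ R := fun k ↦
      ((g_smooth n).continuous_iteratedFDeriv (mod_cast le_top)).bounded_above_of_compact_support
        ((g_supp n).iteratedFDeriv k)
    choose R hR using bound
    have hR0 : ∀ k, 0 ≤ R k := fun k ↦ (norm_nonneg _).trans (hR k 0)
    let M := 1 + ∑ k ∈ Finset.range (n + 1), R k
    have hsum : 0 ≤ ∑ k ∈ Finset.range (n + 1), R k := Finset.sum_nonneg fun k _ ↦ hR0 k
    have hMpos : 0 < M := by positivity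
    refine ⟨M⁻¹ * (1 / 2) ^ n, by positivity, fun k hk x ↦ ?_⟩
    have hkM : R k ≤ M := by
      have := Finset.single_le_sum (fun k _ ↦ hR0 k) (Finset.mem_range.2 (Nat.lt_succ_of_le hk))
      simp only [M]
      linarith
    rw [iteratedFDeriv_const_smul_apply
      ((g_smooth n).contDiffAt.of_le (mod_cast le_top)), norm_smul,
      Real.norm_of_nonneg (by positivity)]
    calc M⁻¹ * (1 / 2) ^ n * ‖iteratedFDeriv ℝ k (g n) x‖
        ≤ M⁻¹ * (1 / 2) ^ n * M := by gcongr; exact (hR k x).trans hkM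
      _ = (1 / 2) ^ n := by field_simp
  choose r r_pos hr using key
  refine ⟨r, r_pos, fun x ↦ ?_, ?_⟩
  · refine hδ.of_norm_bounded fun i ↦ ?_
    simpa using hr i 0 (Nat.zero_le _) x
  · refine contDiff_tsum_of_eventually (v := fun _ i ↦ (1 / 2 : ℝ) ^ i)
      (fun i ↦ (g_smooth i).const_smul (r i)) (fun _ _ ↦ hδ) fun k _ ↦ ?_
    rw [Nat.cofinite_eq_atTop]
    filter_upwards [Filter.eventually_ge_atTop k] with i hi x using hr i k hi x

section

variable {E F : Type*} [NormedAddCommGroup E] [NormedSpace ℝ E] [FiniteDimensional ℝ E]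
  [NormedAddCommGroup F]

open scoped ContDiff in
/-- The value at a point of a local smooth section of a family of subspaces is the value of a
global smooth section with compact support. -/
theorem exists_contDiff_hasCompactSupport_section [NormedSpace ℝ F] (G : E → Submodule ℝ F)
    {U : Set E} {s : E → F} {p : E} (hU : IsOpen U) (hp : p ∈ U) (hs : ContDiffOn ℝ ∞ s U)
    (hsG : ∀ q ∈ U, s q ∈ G q) :
    ∃ t : E → F, ContDiff ℝ ∞ t ∧ HasCompactSupport t ∧ (∀ q, t q ∈ G q) ∧ t p = s p := by
  obtain ⟨φ, φ_sub, φ_supp, φ_smooth, -, φ_one⟩ :=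
    exists_contDiff_tsupport_subset (n := ⊤) (hU.mem_nhds hp)
  refine ⟨fun x ↦ φ x • s x, contDiff_iff_contDiffAt.2 fun x ↦ ?_, φ_supp.smul_right,
    fun q ↦ ?_, by simp [φ_one]⟩
  · by_cases hx : x ∈ tsupport φ
    · exact φ_smooth.contDiffAt.smul (hs.contDiffAt (hU.mem_nhds (φ_sub hx)))
    · refine contDiffAt_const (c := (0 : F)) |>.congr_of_eventuallyEq ?_
      filter_upwards [notMem_tsupport_iff_eventuallyEq.1 hx] with y hy
      simp [hy]
  · by_cases hq : q ∈ U
    · exact (G q).smul_mem _ (hsG q hq)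
    · simp [image_eq_zero_of_notMem_tsupport fun h ↦ hq (φ_sub h)]

variable [InnerProductSpace ℝ F] [FiniteDimensional ℝ F]

open scoped ContDiff RealInnerProductSpace in
/-- A family of subspaces generated by its smooth local sections admits a sequence of compactly
supported smooth global sections whose values at each point have no common orthogonal vector
beyond the orthogonal complement of the subspace. -/
theorem exists_seq_contDiff_sections (G : E → Submodule ℝ F)
    (hG : ∀ p, ∀ v ∈ G p, ∃ (U : Set E) (s : E → F),
      IsOpen U ∧ p ∈ U ∧ ContDiffOn ℝ ∞ s U ∧ (∀ q ∈ U, s q ∈ G q) ∧ s p = v) :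
    ∃ s : ℕ → E → F, (∀ i, ContDiff ℝ ∞ (s i)) ∧ (∀ i, HasCompactSupport (s i)) ∧
      (∀ i q, s i q ∈ G q) ∧ ∀ q w, (∀ i, ⟪s i q, w⟫ = 0) → w ∈ (G q)ᗮ := by
  let Γ := {t : E → F // ContDiff ℝ ∞ t ∧ HasCompactSupport t ∧ ∀ q, t q ∈ G q}
  let O : Γ → Set (E × F) := fun t ↦ {z | ⟪t.1 z.1, z.2⟫ ≠ 0}
  have hO : ∀ t, IsOpen (O t) := fun t ↦ isOpen_ne_fun
    ((t.2.1.continuous.comp continuous_fst).inner continuous_snd) continuous_const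
  have : SecondCountableTopology E :=
    have := FiniteDimensional.proper ℝ E
    secondCountable_of_proper
  have : SecondCountableTopology F :=
    have := FiniteDimensional.proper ℝ F
    secondCountable_of_proper
  obtain ⟨T, T_count, hT⟩ := TopologicalSpace.isOpen_iUnion_countable O hO
  let z : Γ := ⟨fun _ ↦ 0, contDiff_const, HasCompactSupport.zero, fun q ↦ (G q).zero_mem⟩
  obtain ⟨s, hs⟩ := (T_count.insert z).exists_eq_range (Set.insert_nonempty _ _)
  refine ⟨fun i ↦ (s i).1, fun i ↦ (s i).2.1, fun i ↦ (s i).2.2.1, fun i ↦ (s i).2.2.2,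
    fun q w hw ↦ (Submodule.mem_orthogonal _ _).2 fun v hv ↦ ?_⟩
  by_contra hne
  obtain ⟨U, σ, hU, hq, hσ, hσG, rfl⟩ := hG q v hv
  obtain ⟨t, ht, ht_supp, htG, htq⟩ := exists_contDiff_hasCompactSupport_section G hU hq hσ hσG
  have hmem : (q, w) ∈ ⋃ t, O t :=
    Set.mem_iUnion.2 ⟨⟨t, ht, ht_supp, htG⟩, by simpa [O, htq] using hne⟩
  rw [← hT] at hmem
  obtain ⟨t', ht'T, ht'⟩ := Set.mem_iUnion₂.1 hmem
  obtain ⟨i, rfl⟩ : t' ∈ Set.range s := hs ▸ Set.mem_insert_of_mem _ ht'T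
  exact ht' (hw i)

open scoped ContDiff RealInnerProductSpace in
/-- A family of subspaces generated by its smooth local sections is, at every point, the range of
a smooth family of endomorphisms. -/
theorem exists_contDiff_range_eq (G : E → Submodule ℝ F)
    (hG : ∀ p, ∀ v ∈ G p, ∃ (U : Set E) (s : E → F),
      IsOpen U ∧ p ∈ U ∧ ContDiffOn ℝ ∞ s U ∧ (∀ q ∈ U, s q ∈ G q) ∧ s p = v) :
    ∃ A : E → F →L[ℝ] F, ContDiff ℝ ∞ A ∧ ∀ p, (A p : F →ₗ[ℝ] F).range = G p := by
  obtain ⟨s, s_smooth, s_supp, hsG, hs⟩ := exists_seq_contDiff_sections G hG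
  let g : ℕ → E → F →L[ℝ] F := fun i p ↦ (innerSL ℝ (s i p)).smulRight (s i p)
  have g_smooth : ∀ i, ContDiff ℝ ∞ (g i) := fun i ↦
    ((innerSL ℝ).contDiff.comp (s_smooth i)).smulRight (s_smooth i)
  have g_supp : ∀ i, HasCompactSupport (g i) := fun i ↦
    (s_supp i).comp_left (g := fun v : F ↦ (innerSL ℝ v).smulRight v) (by ext; simp)
  obtain ⟨r, r_pos, r_sum, r_smooth⟩ := exists_pos_contDiff_tsum_smul g g_smooth g_supp
  refine ⟨_, r_smooth, fun p ↦ ?_⟩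
  set A : F →L[ℝ] F := ∑' i, r i • g i p
  have hAw : ∀ w, HasSum (fun i ↦ r i • ⟪s i p, w⟫ • s i p) (A w) := fun w ↦ by
    simpa [g] using (r_sum p).hasSum.mapL (ContinuousLinearMap.apply ℝ F w)
  have hle : (A : F →ₗ[ℝ] F).range ≤ G p := by
    rintro _ ⟨w, rfl⟩
    exact (G p).closed_of_finiteDimensional.mem_of_tendsto (hAw w) (Filter.Eventually.of_forall
      fun t ↦ (G p).sum_mem fun i _ ↦ (G p).smul_mem _ ((G p).smul_mem _ (hsG i p)))
  refine hle.antisymm ?_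
  rw [← Submodule.orthogonal_le_orthogonal_iff]
  intro w hw
  refine hs p w ?_
  have hsum : HasSum (fun i ↦ r i * ⟪s i p, w⟫ ^ 2) 0 := by
    have h0 : ⟪w, A w⟫ = 0 := Submodule.inner_left_of_mem_orthogonal
      (LinearMap.mem_range_self (A : F →ₗ[ℝ] F) w) hw
    have h1 := (hAw w).mapL (innerSL ℝ w)
    rw [innerSL_apply_apply, h0] at h1
    refine h1.congr_fun fun i ↦ ?_
    rw [innerSL_apply_apply, inner_smul_right, inner_smul_right, real_inner_comm, sq]
  have hz := (hasSum_zero_iff_of_nonneg fun i ↦ mul_nonneg (r_pos i).le (sq_nonneg _)).1 hsum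
  intro i
  simpa [(r_pos i).ne'] using congrFun hz i

end

/-- **Smooth generalized subbundles of a trivial bundle are globally finitely generated.**
Let `G` be a smooth generalized subbundle of the trivial bundle `ℝⁿ × ℝᵐ`: every `v ∈ G p`
is the value at `p` of a smooth local section of `G` defined on an open neighborhood of `p`.
Then there exist finitely many smooth maps `s 0, …, s (k-1) : ℝⁿ → ℝᵐ`, taking values in
`G`, whose values span `G p` at every point `p`. -/
theorem smooth_subbundle_of_trivial_bundle_globally_finitely_generated {n m : ℕ}
    (G : EuclideanSpace ℝ (Fin n) → Submodule ℝ (EuclideanSpace ℝ (Fin m)))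
    (hG : ∀ p : EuclideanSpace ℝ (Fin n), ∀ v ∈ G p,
      ∃ (U : Set (EuclideanSpace ℝ (Fin n))) (s : EuclideanSpace ℝ (Fin n) → EuclideanSpace ℝ (Fin m)),
        IsOpen U ∧ p ∈ U ∧ ContDiffOn ℝ (⊤ : ℕ∞) s U ∧ (∀ q ∈ U, s q ∈ G q) ∧ s p = v) :
    ∃ (k : ℕ) (s : Fin k → EuclideanSpace ℝ (Fin n) → EuclideanSpace ℝ (Fin m)),
      (∀ i, ContDiff ℝ (⊤ : ℕ∞) (s i)) ∧
      (∀ i p, s i p ∈ G p) ∧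
      (∀ p, G p = Submodule.span ℝ (Set.range fun i ↦ s i p)) := by
  obtain ⟨A, hA, hrange⟩ := exists_contDiff_range_eq G hG
  let b := EuclideanSpace.basisFun (Fin m) ℝ
  refine ⟨m, fun i p ↦ A p (b i), fun i ↦ hA.clm_apply contDiff_const,
    fun i p ↦ hrange p ▸ ⟨b i, rfl⟩, fun p ↦ ?_⟩
  rw [← hrange p, LinearMap.range_eq_map, ← b.toBasis.span_eq, Submodule.map_span,
    ← Set.range_comp]
  simp [Function.comp_def]
end

section
/- Let a ∈ (0, ∞] and let J = (-a, a). In the ring C^∞(J, ℝ) of smooth real-valued functions on J, the set I(J) of smooth functions vanishing identically on (-a, 0] is an ideal that is not finitely generated: there is no finite list g_1, …, g_k ∈ I(J) such that every f ∈ I(J) can be written as f = a_1 g_1 + ⋯ + a_k g_k with a_1, …, a_k ∈ C^∞(J, ℝ). -/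
/-- Membership in the ideal `I(J)` of the ring `C^∞(J, ℝ)` of smooth functions on the
interval `J = (-a, a)` (where `a ∈ (0, ∞]` is modeled as `a : EReal` with `0 < a`):
`f` represents an element of `I(J)` when `f` is smooth on `J` and vanishes identically on
`(-a, 0]`. -/
def MemFlatIdeal (a : EReal) (f : ℝ → ℝ) : Prop :=
  ContDiffOn ℝ (⊤ : ℕ∞) f {x : ℝ | -a < (x : EReal) ∧ (x : EReal) < a} ∧
    ∀ x : ℝ, -a < (x : EReal) → x ≤ 0 → f x = 0

open Filter Topology Asymptotics

theorem isOpen_setOf_neg_lt_coe_and_coe_lt (a : EReal) :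
    IsOpen {x : ℝ | -a < (x : EReal) ∧ (x : EReal) < a} :=
  (isOpen_lt continuous_const continuous_coe_real_ereal).inter
    (isOpen_lt continuous_coe_real_ereal continuous_const)

theorem setOf_neg_lt_coe_and_coe_lt_mem_nhds_zero {a : EReal} (ha : 0 < a) :
    {x : ℝ | -a < (x : EReal) ∧ (x : EReal) < a} ∈ 𝓝 (0 : ℝ) :=
  (isOpen_setOf_neg_lt_coe_and_coe_lt a).mem_nhds
    ⟨EReal.neg_lt_comm.mp (by simpa using ha), by simpa using ha⟩

namespace MemFlatIdeal

variable {a : EReal} {f : ℝ → ℝ}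

theorem apply_zero (hf : MemFlatIdeal a f) (ha : 0 < a) : f 0 = 0 :=
  hf.2 0 (mem_of_mem_nhds (setOf_neg_lt_coe_and_coe_lt_mem_nhds_zero ha)).1 le_rfl

theorem differentiableAt (hf : MemFlatIdeal a f) {x : ℝ}
    (hx : x ∈ {x : ℝ | -a < (x : EReal) ∧ (x : EReal) < a}) : DifferentiableAt ℝ f x :=
  (hf.1.differentiableOn (by simp)).differentiableAt
    ((isOpen_setOf_neg_lt_coe_and_coe_lt a).mem_nhds hx)

protected theorem deriv (hf : MemFlatIdeal a f) (ha : 0 < a) : MemFlatIdeal a (deriv f) := by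
  have hJ := isOpen_setOf_neg_lt_coe_and_coe_lt a
  refine ⟨((contDiffOn_infty_iff_deriv_of_isOpen hJ).1 hf.1).2, fun x hx hx0 => ?_⟩
  have hxJ : x ∈ {x : ℝ | -a < (x : EReal) ∧ (x : EReal) < a} :=
    ⟨hx, lt_of_le_of_lt (by exact_mod_cast hx0) ha⟩
  rw [← (hf.differentiableAt hxJ).derivWithin (uniqueDiffOn_Iic (0 : ℝ) x hx0)]
  have h : f =ᶠ[𝓝[Set.Iic 0] x] fun _ => 0 := by
    filter_upwards [self_mem_nhdsWithin, mem_nhdsWithin_of_mem_nhds (hJ.mem_nhds hxJ)]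
      with y hy hyJ using hf.2 y hyJ.1 hy
  rw [h.derivWithin_eq (hf.2 x hx hx0)]
  simp

theorem isLittleO_pow (ha : 0 < a) (k : ℕ) (hf : MemFlatIdeal a f) :
    f =o[𝓝 0] fun x => x ^ k := by
  have hJ := setOf_neg_lt_coe_and_coe_lt_mem_nhds_zero ha
  induction k generalizing f with
  | zero =>
    simpa [hf.apply_zero ha] using
      (hf.differentiableAt (mem_of_mem_nhds hJ)).continuousAt.tendsto
  | succ k ih =>
    rw [isLittleO_iff]
    intro ε hε
    obtain ⟨δ, hδ, h⟩ := Metric.eventually_nhds_iff_ball.1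
      (((isLittleO_iff.1 (ih (hf.deriv ha))) hε).and hJ)
    filter_upwards [Metric.ball_mem_nhds 0 hδ] with x hx
    have hsub : ∀ y ∈ Metric.closedBall (0 : ℝ) |x|, y ∈ Metric.ball (0 : ℝ) δ := fun y hy => by
      simp only [mem_closedBall_zero_iff, mem_ball_zero_iff, Real.norm_eq_abs] at *
      exact hy.trans_lt hx
    have hmv := (convex_closedBall (0 : ℝ) |x|).norm_image_sub_le_of_norm_deriv_le
      (C := ε * |x| ^ k) (x := 0) (y := x) (f := f)
      (fun y hy => hf.differentiableAt (h y (hsub y hy)).2)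
      (fun y hy => (h y (hsub y hy)).1.trans (by
        rw [norm_pow]
        gcongr
        simpa using hy))
      (by simp) (by simp)
    simpa [hf.apply_zero ha, pow_succ, mul_assoc] using hmv

theorem tendsto_div_pow (hf : MemFlatIdeal a f) (ha : 0 < a) (k : ℕ) :
    Tendsto (fun x => f x / x ^ k) (𝓝 0) (𝓝 0) :=
  (hf.isLittleO_pow ha k).tendsto_div_nhds_zero

theorem hasDerivAt_div_pow (hf : MemFlatIdeal a f) (ha : 0 < a) (k : ℕ) {x : ℝ}
    (hx : x ∈ {x : ℝ | -a < (x : EReal) ∧ (x : EReal) < a}) :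
    HasDerivAt (fun x => f x / x ^ k) (deriv f x / x ^ k - k * (f x / x ^ (k + 1))) x := by
  rcases eq_or_ne x 0 with rfl | hx0
  · simp only [(hf.deriv ha).apply_zero ha, hf.apply_zero ha, zero_div, mul_zero, sub_zero]
    rw [hasDerivAt_iff_tendsto_slope]
    refine ((hf.tendsto_div_pow ha (k + 1)).mono_left nhdsWithin_le_nhds).congr fun y => ?_
    simp [slope_def_field, hf.apply_zero ha, pow_succ, div_div]
  · refine ((hf.differentiableAt hx).hasDerivAt.div (hasDerivAt_pow k x)
      (pow_ne_zero k hx0)).congr_deriv ?_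
    rcases k with _ | k
    · simp
    · simp only [Nat.add_sub_cancel]
      field_simp
      ring

theorem contDiffOn_div_pow (ha : 0 < a) (n k : ℕ) (hf : MemFlatIdeal a f) :
    ContDiffOn ℝ n (fun x => f x / x ^ k) {x : ℝ | -a < (x : EReal) ∧ (x : EReal) < a} := by
  induction n generalizing f k with
  | zero =>
    exact contDiffOn_zero.2 fun x hx =>
      (hf.hasDerivAt_div_pow ha k hx).continuousAt.continuousWithinAt
  | succ n ih =>
    push_cast
    rw [contDiffOn_succ_iff_deriv_of_isOpen (isOpen_setOf_neg_lt_coe_and_coe_lt a)]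
    refine ⟨fun x hx =>
      (hf.hasDerivAt_div_pow ha k hx).differentiableAt.differentiableWithinAt, by simp, ?_⟩
    exact ((ih k (hf.deriv ha)).sub (contDiffOn_const.mul (ih (k + 1) hf))).congr fun x hx =>
      (hf.hasDerivAt_div_pow ha k hx).deriv

theorem div_id (hf : MemFlatIdeal a f) (ha : 0 < a) : MemFlatIdeal a fun x => f x / x :=
  ⟨contDiffOn_infty.2 fun n => by simpa using hf.contDiffOn_div_pow ha n 1,
    fun x hx hx0 => by simp [hf.2 x hx hx0]⟩

end MemFlatIdeal

theorem memFlatIdeal_expNegInvGlue (a : EReal) : MemFlatIdeal a expNegInvGlue :=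
  ⟨expNegInvGlue.contDiff.contDiffOn, fun _ _ hx => expNegInvGlue.zero_of_nonpos hx⟩

/-- Nakayama's argument: if `v = x • C x *ᵥ v` near `0`, then `v` vanishes near `0`. -/
theorem eventually_eq_zero_of_eq_smul_mulVec {k : ℕ} {v : ℝ → Fin k → ℝ}
    {C : ℝ → Matrix (Fin k) (Fin k) ℝ} (hC : ContinuousAt C 0)
    (h : ∀ᶠ x in 𝓝 (0 : ℝ), v x = x • (C x).mulVec (v x)) : ∀ᶠ x in 𝓝 (0 : ℝ), v x = 0 := by
  have hdet : ContinuousAt (fun x => (1 - x • C x).det) 0 :=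
    (continuous_id.matrix_det).continuousAt.comp
      (continuousAt_const.sub (continuousAt_id.smul hC))
  filter_upwards [h, hdet.eventually_ne (y := 0) (by simp)] with x hx hne
  refine Matrix.eq_zero_of_mulVec_eq_zero hne ?_
  rw [Matrix.sub_mulVec, Matrix.one_mulVec, Matrix.smul_mulVec, ← hx, sub_self]

/-- **The ideal of flat functions is not finitely generated.**  Let `a ∈ (0, ∞]` and
`J = (-a, a)`.  In the ring `C^∞(J, ℝ)` (smooth functions on `J` with pointwise
operations), the set `I(J)` of smooth functions vanishing identically on `(-a, 0]` is an
ideal — it contains `0`, is closed under addition, and closed under multiplication by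
arbitrary smooth functions on `J` — which is not finitely generated: there are no
`g 0, …, g (k-1) ∈ I(J)` such that every `f ∈ I(J)` can be written on `J` as
`f = Σ i, c i * g i` with each `c i` smooth on `J`. -/
theorem flat_ideal_not_finitely_generated (a : EReal) (ha : 0 < a) :
    MemFlatIdeal a 0 ∧
    (∀ f g : ℝ → ℝ, MemFlatIdeal a f → MemFlatIdeal a g → MemFlatIdeal a (f + g)) ∧
    (∀ c f : ℝ → ℝ, ContDiffOn ℝ (⊤ : ℕ∞) c {x : ℝ | -a < (x : EReal) ∧ (x : EReal) < a} →
      MemFlatIdeal a f → MemFlatIdeal a (c * f)) ∧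
    ¬∃ (k : ℕ) (g : Fin k → ℝ → ℝ), (∀ i, MemFlatIdeal a (g i)) ∧
        ∀ f : ℝ → ℝ, MemFlatIdeal a f →
          ∃ c : Fin k → ℝ → ℝ,
            (∀ i, ContDiffOn ℝ (⊤ : ℕ∞) (c i) {x : ℝ | -a < (x : EReal) ∧ (x : EReal) < a}) ∧
            ∀ x : ℝ, -a < (x : EReal) → (x : EReal) < a → f x = ∑ i, c i x * g i x := by
  have hJ := setOf_neg_lt_coe_and_coe_lt_mem_nhds_zero ha
  refine ⟨⟨contDiffOn_const, fun _ _ _ => rfl⟩,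
    fun f g hf hg => ⟨hf.1.add hg.1, fun x hx hx0 => by simp [hf.2 x hx hx0, hg.2 x hx hx0]⟩,
    fun c f hc hf => ⟨hc.mul hf.1, fun x hx hx0 => by simp [hf.2 x hx hx0]⟩, ?_⟩
  rintro ⟨k, g, hg, hgen⟩
  choose C hC hCg using fun i => hgen _ ((hg i).div_id ha)
  obtain ⟨c, -, hcg⟩ := hgen _ (memFlatIdeal_expNegInvGlue a)
  have hg0 : ∀ᶠ x in 𝓝 (0 : ℝ), (fun i => g i x) = 0 := by
    refine eventually_eq_zero_of_eq_smul_mulVec (C := fun x => Matrix.of fun i j => C i j x)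
      (continuousAt_pi.2 fun i => continuousAt_pi.2 fun j =>
        (hC i j).continuousOn.continuousAt hJ) ?_
    filter_upwards [hJ] with x hx
    ext i
    have hi := hCg i x hx.1 hx.2
    simp only [Pi.smul_apply, Matrix.mulVec, dotProduct, Matrix.of_apply, smul_eq_mul, ← hi]
    rcases eq_or_ne x 0 with rfl | hx0
    · simp [(hg i).apply_zero ha]
    · field_simp
  have hglue : ∀ᶠ x in 𝓝[>] (0 : ℝ), expNegInvGlue x = 0 := by
    filter_upwards [nhdsWithin_le_nhds hg0, nhdsWithin_le_nhds hJ] with x hx hxJ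
    rw [hcg x hxJ.1 hxJ.2]
    exact Finset.sum_eq_zero fun i _ => by simp [show g i x = 0 from congrFun hx i]
  obtain ⟨x, hx, hpos⟩ := (hglue.and self_mem_nhdsWithin).exists
  exact (expNegInvGlue.pos_of_pos hpos).ne' hx
end
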